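/- arXiv:2501.14609 — 2 statements merged into one kernel-verified Lean document; each statement's English description precedes it below -/
import Mathlib

section
/- Let n ≥ 1, m ≥ 1 with n ≤ m, and Λ ≥ 1. For each i ∈ {1, …, n}, let v_i be a real-valued function on subsets of {1, …, m} that is normalized (v_i(∅) = 0), nonnegative (v_i(S) ≥ 0 for all S), and has marginal values at most Λ (|v_i(S ∪ {g}) − v_i(S)| ≤ Λ for all S ⊆ {1, …, m} and g ∈ {1, …, m}). Then there exists a partition of {1, …, m} into subsets A_1, …, A_n (pairwise disjoint with A_1 ∪ … ∪ A_n = {1, …, m}) such that every A_i is nonempty and |v_i(A_i) − v_j(A_j)| ≤ 5Λ + 1 for all i, j ∈ {1, …, n}. -/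
open Finset Function

/-- The `k`-th vertex of the Kuhn simplex with base `q`, in which coordinate `j` is raised at
step `τ j`. -/
def kuhnVertex {d : ℕ} (q : Fin d → ℕ) (τ : Equiv.Perm (Fin d)) (k : ℕ) : Fin d → ℕ :=
  fun j => q j + if (τ j : ℕ) < k then 1 else 0

/-- The Kuhn simplices triangulating the cube `[0, p]^d`. -/
def kuhnSimplices (d p : ℕ) : Finset ((Fin d → ℕ) × Equiv.Perm (Fin d)) :=
  (Fintype.piFinset fun _ => range p) ×ˢ univ

/-- The labels of the vertices of a Kuhn simplex. -/
def kuhnLabels {d : ℕ} {α : Type*} (l : (Fin d → ℕ) → α)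
    (s : (Fin d → ℕ) × Equiv.Perm (Fin d)) : Fin (d + 1) → α :=
  fun k => l (kuhnVertex s.1 s.2 k)

/-- The facet opposite to vertex `k` carries every nonzero label. -/
def IsDoor {d : ℕ} (l : (Fin d → ℕ) → Fin (d + 1))
    (s : (Fin d → ℕ) × Equiv.Perm (Fin d)) (k : Fin (d + 1)) : Prop :=
  Injective (update (kuhnLabels l s) k 0)

theorem mem_kuhnSimplices {d p : ℕ} {s : (Fin d → ℕ) × Equiv.Perm (Fin d)} :
    s ∈ kuhnSimplices d p ↔ ∀ j, s.1 j < p := by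
  simp [kuhnSimplices]

theorem kuhnVertex_le {d p : ℕ} {s : (Fin d → ℕ) × Equiv.Perm (Fin d)}
    (hs : s ∈ kuhnSimplices d p) (k : ℕ) (j : Fin d) : kuhnVertex s.1 s.2 k j ≤ p := by
  have := mem_kuhnSimplices.1 hs j
  unfold kuhnVertex
  split_ifs <;> omega

open Classical in
theorem card_injective_update_zero {n : ℕ} (a : Fin (n + 1) → Fin (n + 1)) :
    ((#{k | Injective (update a k 0)} : ℕ) : ZMod 2) = if Injective a then 1 else 0 := by
  split_ifs with ha
  · obtain ⟨k₀, hk₀⟩ := Finite.surjective_of_injective ha 0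
    have : ({k | Injective (update a k 0)} : Finset (Fin (n + 1))) = {k₀} := by
      ext k
      simp only [mem_filter, mem_univ, true_and, mem_singleton]
      constructor
      · intro hk
        by_contra hne
        have := @hk k k₀ (by rw [update_self, update_of_ne (Ne.symm hne), hk₀])
        exact hne this
      · rintro rfl
        rwa [← hk₀, update_eq_self]
    simp [this]
  · by_cases hex : ∃ k, Injective (update a k 0)
    · obtain ⟨k, hk⟩ := hex
      have hak : a k ≠ 0 := by
        intro h
        rw [← h, update_eq_self] at hk
        exact ha hk
      obtain ⟨k', hk'⟩ := Finite.surjective_of_injective hk (a k)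
      have hne : k' ≠ k := by
        rintro rfl
        rw [update_self] at hk'
        exact hak hk'.symm
      rw [update_of_ne hne] at hk'
      have : ({k | Injective (update a k 0)} : Finset (Fin (n + 1))) = {k, k'} := by
        ext j
        simp only [mem_filter, mem_univ, true_and, mem_insert, mem_singleton]
        constructor
        · intro hj
          by_contra! hjk
          refine hne (@hj k' k ?_)
          rw [update_of_ne hjk.2.symm, update_of_ne hjk.1.symm, hk']
        · rintro (rfl | rfl)
          · exact hk
          · have : update a j 0 = update a k 0 ∘ Equiv.swap k j := by
              funext i
              rcases eq_or_ne i k with rfl | hik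
              · simp [update_of_ne hne, update_of_ne hne.symm, hk']
              rcases eq_or_ne i j with rfl | hij
              · simp
              simp [Equiv.swap_apply_of_ne_of_ne hik hij, update_of_ne hik, update_of_ne hij]
            rw [this]
            exact hk.comp (Equiv.injective _)
      rw [this, card_pair hne.symm]
      rfl
    · push Not at hex
      simp [hex]

open Classical in
theorem card_isDoor_middle {e : ℕ} (p : ℕ) (l : (Fin (e + 1) → ℕ) → Fin (e + 2)) (i : Fin e) :
    ((#{s ∈ kuhnSimplices (e + 1) p | IsDoor l s i.succ.castSucc} : ℕ) : ZMod 2) = 0 := by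
  have key : ∀ (q : Fin (e + 1) → ℕ) (τ : Equiv.Perm (Fin (e + 1))),
      IsDoor l (q, τ) i.succ.castSucc →
        IsDoor l (q, Equiv.swap i.castSucc i.succ * τ) i.succ.castSucc := by
    intro q τ h
    unfold IsDoor at h ⊢
    convert h using 1
    funext k
    rcases eq_or_ne k i.succ.castSucc with rfl | hk
    · simp
    · rw [update_of_ne hk, update_of_ne hk]
      unfold kuhnLabels
      congr 1
      funext j
      have hk' : (k : ℕ) ≠ i + 1 := fun h => hk (Fin.ext (by simpa using h))
      have hlt : (Equiv.swap i.castSucc i.succ (τ j) : ℕ) < k ↔ (τ j : ℕ) < k := by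
        rcases eq_or_ne (τ j) i.castSucc with h1 | h1
        · rw [h1, Equiv.swap_apply_left, Fin.val_succ, Fin.val_castSucc]
          omega
        rcases eq_or_ne (τ j) i.succ with h2 | h2
        · rw [h2, Equiv.swap_apply_right, Fin.val_succ, Fin.val_castSucc]
          omega
        rw [Equiv.swap_apply_of_ne_of_ne h1 h2]
      exact congrArg (q j + ·) (if_congr hlt rfl rfl)
  rw [card_eq_sum_ones, Nat.cast_sum]
  refine Finset.sum_involution (fun s _ => (s.1, Equiv.swap i.castSucc i.succ * s.2))
    ?_ ?_ ?_ ?_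
  · intros; rfl
  · rintro ⟨q, τ⟩ _ _ h
    have h := congrArg (fun s => s.2) h
    simp only [mul_eq_right] at h
    have := congrArg (fun σ => σ i.castSucc) h
    simp only [Equiv.swap_apply_left, Equiv.Perm.one_apply] at this
    simpa using congrArg Fin.val this
  · rintro ⟨q, τ⟩ hs
    rw [mem_filter, mem_kuhnSimplices] at hs ⊢
    exact ⟨hs.1, key q τ hs.2⟩
  · rintro ⟨q, τ⟩ _
    simp [← mul_assoc]

theorem isDoor_rotate {e : ℕ} (l : (Fin (e + 1) → ℕ) → Fin (e + 2)) (q : Fin (e + 1) → ℕ)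
    (τ : Equiv.Perm (Fin (e + 1))) :
    IsDoor l (q, finRotate (e + 1) * τ) 0 ↔
      IsDoor l (q + Pi.single (τ.symm (Fin.last e)) 1, τ) (Fin.last (e + 1)) := by
  have : update (kuhnLabels l (q + Pi.single (τ.symm (Fin.last e)) 1, τ)) (Fin.last (e + 1)) 0 =
      update (kuhnLabels l (q, finRotate (e + 1) * τ)) 0 0 ∘ finRotate (e + 2) := by
    funext k
    refine Fin.lastCases ?_ (fun k => ?_) k
    · simp
    · have h1 : finRotate (e + 2) k.castSucc = k.succ := by
        simp
      rw [comp_apply, h1, update_of_ne (Fin.castSucc_lt_last k).ne,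
        update_of_ne (Fin.succ_ne_zero k)]
      unfold kuhnLabels
      congr 1
      funext j
      simp only [kuhnVertex, Equiv.Perm.mul_apply, Pi.add_apply, coe_finRotate,
        Fin.val_castSucc, Fin.val_succ]
      rcases eq_or_ne j (τ.symm (Fin.last e)) with rfl | hj
      · have := k.2
        simp
        omega
      · have : τ j ≠ Fin.last e := fun h => hj (by simp [← h])
        simp [this, hj]
  unfold IsDoor
  rw [this, Equiv.injective_comp]

theorem not_isDoor_last_of_eq_zero {e p : ℕ} {l : (Fin (e + 1) → ℕ) → Fin (e + 2)}
    (h0 : ∀ x, (∀ j, x j ≤ p) → ∀ j, x j = 0 → l x ≠ j.succ)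
    {s : (Fin (e + 1) → ℕ) × Equiv.Perm (Fin (e + 1))} (hs : s ∈ kuhnSimplices (e + 1) p)
    (hz : s.1 (s.2.symm (Fin.last e)) = 0) : ¬ IsDoor l s (Fin.last (e + 1)) := by
  intro h
  obtain ⟨k, hk⟩ := Finite.surjective_of_injective h (s.2.symm (Fin.last e)).succ
  have hkl : k ≠ Fin.last (e + 1) := by
    rintro rfl
    rw [update_self] at hk
    exact (Fin.succ_ne_zero _ hk.symm)
  rw [update_of_ne hkl] at hk
  refine h0 _ (kuhnVertex_le hs k) _ ?_ hk
  have := Fin.val_lt_last hkl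
  simp [kuhnVertex, hz]
  omega

open Classical in
theorem card_isDoor_zero_interior {e p : ℕ} (l : (Fin (e + 1) → ℕ) → Fin (e + 2))
    (h0 : ∀ x, (∀ j, x j ≤ p) → ∀ j, x j = 0 → l x ≠ j.succ) :
    #{s ∈ kuhnSimplices (e + 1) p | IsDoor l s 0 ∧ s.1 (s.2.symm 0) + 1 ≠ p} =
      #{s ∈ kuhnSimplices (e + 1) p | IsDoor l s (Fin.last (e + 1))} := by
  symm
  have hinv : ∀ τ : Equiv.Perm (Fin (e + 1)),
      (finRotate (e + 1) * τ).symm 0 = τ.symm (Fin.last e) := by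
    intro τ
    rw [Equiv.symm_apply_eq]
    simp
  refine card_nbij' (fun s => (s.1 - Pi.single (s.2.symm (Fin.last e)) 1, finRotate (e + 1) * s.2))
    (fun s => (s.1 + Pi.single (s.2.symm 0) 1, (finRotate (e + 1))⁻¹ * s.2)) ?_ ?_ ?_ ?_
  · rintro ⟨q, τ⟩ hs
    simp only [coe_filter, Set.mem_ofPred_eq] at hs ⊢
    have hpos : q (τ.symm (Fin.last e)) ≠ 0 := fun h =>
      not_isDoor_last_of_eq_zero h0 hs.1 h hs.2
    have hlt := mem_kuhnSimplices.1 hs.1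
    refine ⟨mem_kuhnSimplices.2 fun j => ?_, (isDoor_rotate _ _ _).2 ?_, ?_⟩
    · exact (Nat.sub_le _ _).trans_lt (hlt j)
    · convert hs.2
      funext j
      rcases eq_or_ne j (τ.symm (Fin.last e)) with rfl | hj
      · simp; omega
      · simp [hj]
    · have := hlt (τ.symm (Fin.last e))
      rw [hinv]
      simp at this ⊢
      omega
  · rintro ⟨q, τ⟩ hs
    simp only [coe_filter, Set.mem_ofPred_eq] at hs ⊢
    obtain ⟨σ, rfl⟩ : ∃ σ, τ = finRotate (e + 1) * σ := ⟨(finRotate (e + 1))⁻¹ * τ, by simp⟩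
    rw [hinv] at hs ⊢
    rw [inv_mul_cancel_left]
    have hlt := mem_kuhnSimplices.1 hs.1
    refine ⟨mem_kuhnSimplices.2 fun j => ?_, (isDoor_rotate _ _ _).1 hs.2.1⟩
    have h1 := hlt j
    have h2 := hs.2.2
    rcases eq_or_ne j (σ.symm (Fin.last e)) with rfl | hj
    · simp at h1 ⊢; omega
    · simpa [hj] using h1
  · rintro ⟨q, τ⟩ hs
    simp only [coe_filter, Set.mem_ofPred_eq] at hs
    have hpos : q (τ.symm (Fin.last e)) ≠ 0 := fun h =>
      not_isDoor_last_of_eq_zero h0 hs.1 h hs.2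
    simp only [hinv, inv_mul_cancel_left]
    congr 1
    funext j
    rcases eq_or_ne j (τ.symm (Fin.last e)) with rfl | hj
    · simp; omega
    · simp [hj]
  · rintro ⟨q, τ⟩ hs
    obtain ⟨σ, rfl⟩ : ∃ σ, τ = finRotate (e + 1) * σ := ⟨(finRotate (e + 1))⁻¹ * τ, by simp⟩
    simp only [hinv, inv_mul_cancel_left]
    congr 1
    funext j
    simp

/-- The labelling induced on the face where the first coordinate equals `p`. -/
def faceLabel {e : ℕ} (p : ℕ) (l : (Fin (e + 1) → ℕ) → Fin (e + 2)) :
    (Fin e → ℕ) → Fin (e + 1) :=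
  fun x => Fin.predAbove 0 (l (Fin.cons p x))

theorem succ_faceLabel {e p : ℕ} {l : (Fin (e + 1) → ℕ) → Fin (e + 2)}
    (hp : ∀ x, (∀ j, x j ≤ p) → ∀ j, x j = p → j.succ ≤ l x) {x : Fin e → ℕ}
    (hx : ∀ j, x j ≤ p) : (faceLabel p l x).succ = l (Fin.cons p x) := by
  have h := hp (Fin.cons p x) (Fin.cases (by simp) (by simpa using hx)) 0 (by simp)
  have hne : l (Fin.cons p x) ≠ 0 := fun h' => by simp [h'] at h
  exact Fin.succ_predAbove_zero hne

theorem isDoor_zero_face {e p : ℕ} {l : (Fin (e + 1) → ℕ) → Fin (e + 2)}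
    (hpos : 0 < p) (hp : ∀ x, (∀ j, x j ≤ p) → ∀ j, x j = p → j.succ ≤ l x)
    {s : (Fin e → ℕ) × Equiv.Perm (Fin e)} (hs : s ∈ kuhnSimplices e p) :
    IsDoor l (Fin.cons (p - 1) s.1, Equiv.Perm.decomposeFin.symm (0, s.2)) 0 ↔
      Injective (kuhnLabels (faceLabel p l) s) := by
  have : update (kuhnLabels l (Fin.cons (p - 1) s.1, Equiv.Perm.decomposeFin.symm (0, s.2))) 0 0 =
      Fin.cons 0 (Fin.succ ∘ kuhnLabels (faceLabel p l) s) := by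
    funext k
    refine Fin.cases ?_ (fun k => ?_) k
    · simp
    · rw [update_of_ne (Fin.succ_ne_zero k), Fin.cons_succ, comp_apply]
      unfold kuhnLabels
      rw [succ_faceLabel hp (kuhnVertex_le hs k)]
      congr 1
      funext j
      refine Fin.cases ?_ (fun j => ?_) j
      · simp [kuhnVertex]
        omega
      · simp [kuhnVertex]
  unfold IsDoor
  rw [this, Fin.cons_injective_iff]
  constructor
  · exact fun h => Injective.of_comp h.2
  · refine fun h => ⟨?_, (Fin.succ_injective _).comp h⟩
    rintro ⟨k, hk⟩
    exact Fin.succ_ne_zero _ hk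

theorem symm_zero_eq_zero_of_isDoor {e p : ℕ} {l : (Fin (e + 1) → ℕ) → Fin (e + 2)}
    (hp : ∀ x, (∀ j, x j ≤ p) → ∀ j, x j = p → j.succ ≤ l x)
    {s : (Fin (e + 1) → ℕ) × Equiv.Perm (Fin (e + 1))} (hs : s ∈ kuhnSimplices (e + 1) p)
    (h : IsDoor l s 0) (hz : s.1 (s.2.symm 0) + 1 = p) : s.2.symm 0 = 0 := by
  obtain ⟨k, hk⟩ := Finite.surjective_of_injective h (Fin.succ 0)
  have hk0 : k ≠ 0 := by
    rintro rfl
    rw [update_self] at hk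
    exact (Fin.succ_ne_zero _ hk.symm)
  rw [update_of_ne hk0] at hk
  have hkpos : 0 < (k : ℕ) := Fin.pos_iff_ne_zero.2 hk0
  have := hp _ (kuhnVertex_le hs k) (s.2.symm 0) (by simp [kuhnVertex, hkpos, hz])
  unfold kuhnLabels at hk
  rw [hk, Fin.succ_le_succ_iff] at this
  exact le_antisymm this (Fin.zero_le _)

open Classical in
theorem card_isDoor_zero_boundary {e p : ℕ} {l : (Fin (e + 1) → ℕ) → Fin (e + 2)}
    (hpos : 0 < p) (hp : ∀ x, (∀ j, x j ≤ p) → ∀ j, x j = p → j.succ ≤ l x) :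
    #{s ∈ kuhnSimplices (e + 1) p | IsDoor l s 0 ∧ s.1 (s.2.symm 0) + 1 = p} =
      #{s ∈ kuhnSimplices e p | Injective (kuhnLabels (faceLabel p l) s)} := by
  symm
  refine card_bij
    (fun s _ => (Fin.cons (p - 1) s.1, Equiv.Perm.decomposeFin.symm (0, s.2))) ?_ ?_ ?_
  · intro s hs
    simp only [mem_filter] at hs ⊢
    refine ⟨mem_kuhnSimplices.2 fun j => ?_,
      (isDoor_zero_face hpos hp hs.1).2 hs.2, ?_⟩
    · refine Fin.cases ?_ (fun j => ?_) j
      · simpa using hpos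
      · simpa using mem_kuhnSimplices.1 hs.1 j
    · have : (Equiv.Perm.decomposeFin.symm (0, s.2)).symm 0 = 0 := by
        rw [Equiv.symm_apply_eq]; simp
      rw [this]
      simp
      omega
  · rintro ⟨q, τ⟩ _ ⟨q', τ'⟩ _ h
    simpa using h
  · rintro ⟨q, τ⟩ hs
    simp only [mem_filter] at hs
    obtain ⟨hs, hd, hz⟩ := hs
    have h0 := symm_zero_eq_zero_of_isDoor hp hs hd hz
    simp only at h0 hz
    rw [h0] at hz
    obtain ⟨⟨i, σ⟩, rfl⟩ := Equiv.Perm.decomposeFin.symm.surjective τ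
    have hi : i = 0 := by
      rw [Equiv.symm_apply_eq] at h0
      simpa using h0.symm
    subst hi
    have hq : Fin.cons (p - 1) (Fin.tail q) = q := by
      conv_rhs => rw [← Fin.cons_self_tail q]
      congr 1
      omega
    have hmem : (Fin.tail q, σ) ∈ kuhnSimplices e p :=
      mem_kuhnSimplices.2 fun j => mem_kuhnSimplices.1 hs j.succ
    refine ⟨(Fin.tail q, σ), ?_, by simp [hq]⟩
    rw [mem_filter]
    refine ⟨hmem, (isDoor_zero_face hpos hp hmem).1 ?_⟩
    simpa only [hq] using hd

open Classical in
/-- Sperner's lemma for the Kuhn triangulation of a cube. -/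
theorem card_fully_labelled {d p : ℕ} (hpos : 0 < p) (l : (Fin d → ℕ) → Fin (d + 1))
    (h0 : ∀ x, (∀ j, x j ≤ p) → ∀ j, x j = 0 → l x ≠ j.succ)
    (hp : ∀ x, (∀ j, x j ≤ p) → ∀ j, x j = p → j.succ ≤ l x) :
    ((#{s ∈ kuhnSimplices d p | Injective (kuhnLabels l s)} : ℕ) : ZMod 2) = 1 := by
  induction d with
  | zero =>
    have : ∀ s, Injective (kuhnLabels l s) := fun s a b _ => Subsingleton.elim (α := Fin 1) a b
    simp [this, kuhnSimplices]
  | succ e ih =>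
    have hdoors : ((#{s ∈ kuhnSimplices (e + 1) p | Injective (kuhnLabels l s)} : ℕ) : ZMod 2) =
        ∑ k, ((#{s ∈ kuhnSimplices (e + 1) p | IsDoor l s k} : ℕ) : ZMod 2) := by
      simp only [card_filter, Nat.cast_sum, Nat.cast_ite, Nat.cast_one, Nat.cast_zero]
      rw [sum_comm]
      refine sum_congr rfl fun s _ => ?_
      rw [← card_injective_update_zero, card_filter, Nat.cast_sum]
      simp only [Nat.cast_ite, Nat.cast_one, Nat.cast_zero]
      exact sum_congr rfl fun _ _ => if_congr Iff.rfl rfl rfl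
    have hsplit : #{s ∈ kuhnSimplices (e + 1) p | IsDoor l s 0} =
        #{s ∈ kuhnSimplices (e + 1) p | IsDoor l s 0 ∧ s.1 (s.2.symm 0) + 1 = p} +
        #{s ∈ kuhnSimplices (e + 1) p | IsDoor l s 0 ∧ s.1 (s.2.symm 0) + 1 ≠ p} := by
      rw [← filter_filter, ← filter_filter, card_filter_add_card_filter_not]
    rw [hdoors, Fin.sum_univ_castSucc, Fin.sum_univ_succ,
      sum_eq_zero fun i _ => card_isDoor_middle p l i, add_zero, Fin.castSucc_zero, hsplit,
      card_isDoor_zero_interior l h0, card_isDoor_zero_boundary hpos hp, Nat.cast_add,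
      add_assoc, CharTwo.add_self_eq_zero, add_zero]
    have hcons : ∀ x : Fin e → ℕ, (∀ j, x j ≤ p) → ∀ j, (Fin.cons p x : Fin (e + 1) → ℕ) j ≤ p :=
      fun x hx => Fin.cases (by simp) (by simpa using hx)
    refine ih (faceLabel p l) (fun x hx j hj h => ?_) (fun x hx j hj => ?_)
    · refine h0 _ (hcons x hx) j.succ (by simpa using hj) ?_
      rw [← succ_faceLabel hp hx, h]
    · have := hp _ (hcons x hx) j.succ (by simpa using hj)
      rwa [← succ_faceLabel hp hx, Fin.succ_le_succ_iff] at this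

/-- A cube whose vertices carry all labels. -/
theorem exists_fully_labelled_cube {d p : ℕ} (hpos : 0 < p) (l : (Fin d → ℕ) → Fin (d + 1))
    (h0 : ∀ x, (∀ j, x j ≤ p) → ∀ j, x j = 0 → l x ≠ j.succ)
    (hp : ∀ x, (∀ j, x j ≤ p) → ∀ j, x j = p → j.succ ≤ l x) :
    ∃ q : Fin d → ℕ, (∀ j, q j ≤ p) ∧ ∀ i, ∃ x : Fin d → ℕ,
      (∀ j, x j ≤ p) ∧ (∀ j, q j ≤ x j ∧ x j ≤ q j + 1) ∧ l x = i := by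
  classical
  have h := card_fully_labelled hpos l h0 hp
  obtain ⟨s, hs⟩ : ({s ∈ kuhnSimplices d p | Injective (kuhnLabels l s)} : Finset _).Nonempty := by
    rw [nonempty_iff_ne_empty]
    intro h'
    simp [h'] at h
  rw [mem_filter] at hs
  refine ⟨s.1, fun j => (mem_kuhnSimplices.1 hs.1 j).le, fun i => ?_⟩
  obtain ⟨k, hk⟩ := Finite.surjective_of_injective hs.2 i
  refine ⟨_, kuhnVertex_le hs.1 k, fun j => ?_, hk⟩
  unfold kuhnVertex
  split_ifs <;> omega

/-- The items in positions `a, …, b - 1`. -/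
def itemIco (m a b : ℕ) : Finset (Fin m) := {g | a ≤ (g : ℕ) ∧ (g : ℕ) < b}

section Marginals

variable {m : ℕ} {Λ : ℝ} {f : Finset (Fin m) → ℝ}

theorem abs_sub_le_of_eq_or_eq_insert (hΛ : 0 ≤ Λ) (hf : ∀ S g, |f (insert g S) - f S| ≤ Λ)
    {S T : Finset (Fin m)} (h : T = S ∨ ∃ g, T = insert g S) : |f T - f S| ≤ Λ := by
  rcases h with rfl | ⟨g, rfl⟩
  · simpa using hΛ
  · exact hf S g

theorem abs_sub_itemIco_succ_left_le (hΛ : 0 ≤ Λ) (hf : ∀ S g, |f (insert g S) - f S| ≤ Λ)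
    (a b : ℕ) : |f (itemIco m a b) - f (itemIco m (a + 1) b)| ≤ Λ := by
  refine abs_sub_le_of_eq_or_eq_insert hΛ hf ?_
  by_cases h : a < m ∧ a < b
  · refine Or.inr ⟨⟨a, h.1⟩, ?_⟩
    ext g
    simp only [itemIco, mem_filter, mem_univ, true_and, mem_insert, Fin.ext_iff]
    omega
  · refine Or.inl ?_
    ext g
    have := g.2
    simp only [itemIco, mem_filter, mem_univ, true_and]
    omega

theorem abs_sub_itemIco_succ_right_le (hΛ : 0 ≤ Λ) (hf : ∀ S g, |f (insert g S) - f S| ≤ Λ)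
    (a b : ℕ) : |f (itemIco m a (b + 1)) - f (itemIco m a b)| ≤ Λ := by
  refine abs_sub_le_of_eq_or_eq_insert hΛ hf ?_
  by_cases h : b < m ∧ a ≤ b
  · refine Or.inr ⟨⟨b, h.1⟩, ?_⟩
    ext g
    simp only [itemIco, mem_filter, mem_univ, true_and, mem_insert, Fin.ext_iff]
    omega
  · refine Or.inl ?_
    ext g
    have := g.2
    simp only [itemIco, mem_filter, mem_univ, true_and]
    omega

theorem abs_sub_itemIco_le (hΛ : 0 ≤ Λ) (hf : ∀ S g, |f (insert g S) - f S| ≤ Λ)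
    {a a' b b' : ℕ} (ha : a ≤ a') (ha' : a' ≤ a + 1) (hb : b ≤ b') (hb' : b' ≤ b + 1) :
    |f (itemIco m a b) - f (itemIco m a' b')| ≤ 2 * Λ := by
  have h1 : |f (itemIco m a b) - f (itemIco m a' b)| ≤ Λ := by
    obtain rfl | rfl : a' = a ∨ a' = a + 1 := by omega
    · simpa using hΛ
    · exact abs_sub_itemIco_succ_left_le hΛ hf a b
  have h2 : |f (itemIco m a' b) - f (itemIco m a' b')| ≤ Λ := by
    obtain rfl | rfl : b' = b ∨ b' = b + 1 := by omega
    · simpa using hΛ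
    · rw [abs_sub_comm]
      exact abs_sub_itemIco_succ_right_le hΛ hf a' b
  linarith [abs_sub_le (f (itemIco m a b)) (f (itemIco m a' b)) (f (itemIco m a' b'))]

end Marginals

section Cuts

variable {d p : ℕ} {x y : Fin d → ℕ}

/-- The decreasing sequence of cut points in `[0, p]` determined by a point of the cube:
agent `i` receives the segment between `cutPoint p x (i + 1)` and `cutPoint p x i`. -/
def cutPoint (p : ℕ) (x : Fin d → ℕ) : ℕ → ℕ
  | 0 => p
  | k + 1 => sup {j : Fin d | k ≤ (j : ℕ)} x

theorem antitone_cutPoint (hx : ∀ j, x j ≤ p) : Antitone (cutPoint p x) := by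
  refine antitone_nat_of_succ_le fun k => ?_
  cases k with
  | zero => exact Finset.sup_le fun j _ => hx j
  | succ k =>
    refine sup_mono fun j hj => ?_
    simp only [mem_filter, mem_univ, true_and] at hj ⊢
    omega

theorem cutPoint_eq_zero : cutPoint p x (d + 1) = 0 := by
  have : ({j : Fin d | d ≤ (j : ℕ)} : Finset (Fin d)) = ∅ := by
    ext j
    simp
  simp [cutPoint, this]

theorem cutPoint_mono (h : ∀ j, x j ≤ y j) (k : ℕ) : cutPoint p x k ≤ cutPoint p y k := by
  cases k with
  | zero => exact le_rfl
  | succ k => exact sup_mono_fun fun j _ => h j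

theorem cutPoint_le_add_one (h : ∀ j, y j ≤ x j + 1) (k : ℕ) :
    cutPoint p y k ≤ cutPoint p x k + 1 := by
  cases k with
  | zero => exact Nat.le_succ p
  | succ k => exact Finset.sup_le fun j hj => (h j).trans (Nat.succ_le_succ (le_sup hj))

theorem cutPoint_succ_le_of_eq_zero {j : Fin d} (h : x j = 0) :
    cutPoint p x (j + 1) ≤ cutPoint p x (j + 2) := by
  refine Finset.sup_le fun i hi => ?_
  simp only [mem_filter, mem_univ, true_and] at hi
  rcases eq_or_ne i j with rfl | hij
  · simp [h]
  · have : (i : ℕ) ≠ j := fun h => hij (Fin.ext h)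
    refine le_sup (f := x) ?_
    simp only [mem_filter, mem_univ, true_and]
    omega

theorem le_cutPoint_of_eq {j : Fin d} (h : x j = p) {k : ℕ} (hk : k ≤ j + 1) :
    p ≤ cutPoint p x k := by
  cases k with
  | zero => exact le_rfl
  | succ k =>
    rw [← h]
    refine le_sup (f := x) ?_
    simp only [mem_filter, mem_univ, true_and]
    omega

/-- The boundary positions of the bundles: the cut points, spread out so that every bundle gets
one additional item. -/
def bundleEnd (p : ℕ) (x : Fin d → ℕ) (i : ℕ) : ℕ := cutPoint p x i + (d + 1 - i)

/-- The bundle of agent `i` at a point of the cube. -/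
def bundle (m p : ℕ) (x : Fin d → ℕ) (i : ℕ) : Finset (Fin m) :=
  itemIco m (bundleEnd p x (i + 1)) (bundleEnd p x i)

theorem antitone_bundleEnd (hx : ∀ j, x j ≤ p) : Antitone (bundleEnd p x) := by
  intro i j hij
  have := antitone_cutPoint hx hij
  unfold bundleEnd
  omega

theorem disjoint_bundle (m : ℕ) (hx : ∀ j, x j ≤ p) {i j : ℕ} (hij : i ≠ j) :
    Disjoint (bundle m p x i) (bundle m p x j) := by
  rw [Finset.disjoint_left]
  intro g hi hj
  simp only [bundle, itemIco, mem_filter, mem_univ, true_and] at hi hj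
  rcases Nat.lt_or_gt_of_ne hij with h | h
  · have := antitone_bundleEnd hx (Nat.succ_le_of_lt h)
    simp only [Nat.succ_eq_add_one] at this
    omega
  · have := antitone_bundleEnd hx (Nat.succ_le_of_lt h)
    simp only [Nat.succ_eq_add_one] at this
    omega

theorem exists_mem_bundle {m : ℕ} (hm : m = p + (d + 1)) (x : Fin d → ℕ) (g : Fin m) :
    ∃ i : Fin (d + 1), g ∈ bundle m p x i := by
  have hex : ∃ k, bundleEnd p x k ≤ (g : ℕ) := ⟨d + 1, by simp [bundleEnd, cutPoint_eq_zero]⟩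
  have h0 : Nat.find hex ≠ 0 := by
    intro h
    have := Nat.find_spec hex
    rw [h] at this
    have hg := g.2
    simp only [bundleEnd, cutPoint] at this
    omega
  have hle : Nat.find hex ≤ d + 1 := Nat.find_min' hex (by simp [bundleEnd, cutPoint_eq_zero])
  obtain ⟨k, hk⟩ := Nat.exists_eq_succ_of_ne_zero h0
  have hlt := Nat.find_min hex (m := k) (by omega)
  have hspec := Nat.find_spec hex
  rw [hk] at hspec
  refine ⟨⟨k, by omega⟩, ?_⟩
  simp only [bundle, itemIco, mem_filter, mem_univ, true_and]
  exact ⟨hspec, not_le.1 hlt⟩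

theorem bundle_nonempty {m : ℕ} (hm : m = p + (d + 1)) (hx : ∀ j, x j ≤ p) (i : Fin (d + 1)) :
    (bundle m p x i).Nonempty := by
  have h1 := antitone_cutPoint hx (Nat.le_succ i)
  have h2 : cutPoint p x i ≤ p := antitone_cutPoint hx (Nat.zero_le i)
  have h3 := i.2
  rw [Nat.succ_eq_add_one] at h1
  refine ⟨⟨bundleEnd p x (i + 1), ?_⟩, ?_⟩
  · unfold bundleEnd
    omega
  · refine mem_filter.2 ⟨mem_univ _, le_rfl, ?_⟩
    change bundleEnd p x (i + 1) < bundleEnd p x i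
    unfold bundleEnd
    omega

theorem exists_cutPoint_lt (hpos : 0 < p) (x : Fin d → ℕ) :
    ∃ i : Fin (d + 1), cutPoint p x (i + 1) < cutPoint p x i := by
  by_contra! h
  have : ∀ k ≤ d + 1, p ≤ cutPoint p x k := by
    intro k
    induction k with
    | zero => exact fun _ => le_rfl
    | succ k ih => exact fun hk => (ih (by omega)).trans (h ⟨k, by omega⟩)
  have := this (d + 1) le_rfl
  rw [cutPoint_eq_zero] at this
  omega

theorem abs_sub_bundle_le {m : ℕ} {Λ : ℝ} {f : Finset (Fin m) → ℝ} (hΛ : 0 ≤ Λ)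
    (hf : ∀ S g, |f (insert g S) - f S| ≤ Λ) (h : ∀ j, x j ≤ y j ∧ y j ≤ x j + 1) (i : ℕ) :
    |f (bundle m p x i) - f (bundle m p y i)| ≤ 2 * Λ := by
  have hl := fun k => cutPoint_mono (p := p) (fun j => (h j).1) k
  have hu := fun k => cutPoint_le_add_one (p := p) (fun j => (h j).2) k
  have h1 := hl i
  have h2 := hl (i + 1)
  have h3 := hu i
  have h4 := hu (i + 1)
  apply abs_sub_itemIco_le hΛ hf <;> unfold bundleEnd <;> omega

theorem le_of_cutPoint_eq {m : ℕ} {Λ : ℝ} {f : Finset (Fin m) → ℝ} (hΛ : 0 ≤ Λ)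
    (h0 : f ∅ = 0) (hf : ∀ S g, |f (insert g S) - f S| ≤ Λ) {i : Fin (d + 1)}
    (h : cutPoint p x (i + 1) = cutPoint p x i) : f (bundle m p x i) ≤ Λ := by
  have hend : bundleEnd p x i = bundleEnd p x (i + 1) + 1 := by
    unfold bundleEnd
    have := i.2
    omega
  have hempty : ∀ a, itemIco m a a = ∅ := fun a => by
    ext g
    simp [itemIco]
  have := abs_sub_itemIco_succ_right_le hΛ hf (bundleEnd p x (i + 1)) (bundleEnd p x (i + 1))
  rw [hempty, h0, sub_zero] at this
  unfold bundle
  rw [hend]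
  exact (le_abs_self _).trans this

/-- Some agent with a bundle of at least two items is almost best off. -/
theorem exists_almost_best {m : ℕ} {Λ : ℝ} {v : Fin (d + 1) → Finset (Fin m) → ℝ} (hΛ : 0 ≤ Λ)
    (hnorm : ∀ i, v i ∅ = 0) (hnonneg : ∀ i S, 0 ≤ v i S)
    (hmarg : ∀ i S g, |v i (insert g S) - v i S| ≤ Λ) (hpos : 0 < p) (hx : ∀ j, x j ≤ p) :
    ∃ i : Fin (d + 1), cutPoint p x (i + 1) < cutPoint p x i ∧
      ∀ j : Fin (d + 1), v j (bundle m p x j) ≤ v i (bundle m p x i) + Λ := by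
  obtain ⟨i₀, hi₀⟩ := exists_cutPoint_lt hpos x
  obtain ⟨i, hi, hmax⟩ := exists_max_image
    ({i : Fin (d + 1) | cutPoint p x (i + 1) < cutPoint p x i} : Finset (Fin (d + 1)))
    (fun i => v i (bundle m p x i)) ⟨i₀, by simpa using hi₀⟩
  simp only [mem_filter, mem_univ, true_and] at hi hmax
  refine ⟨i, hi, fun j => ?_⟩
  by_cases hj : cutPoint p x (j + 1) < cutPoint p x j
  · linarith [hmax j hj]
  · have heq := le_antisymm (antitone_cutPoint hx (Nat.le_succ j)) (not_lt.1 hj)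
    linarith [le_of_cutPoint_eq hΛ (hnorm j) (hmarg j) heq, hnonneg i (bundle m p x i)]

end Cuts

/-- With more items than agents, some point of the cube yields an allocation that is equitable
within `5 * Λ`. -/
theorem exists_equitable_bundle {d m p : ℕ} {Λ : ℝ} {v : Fin (d + 1) → Finset (Fin m) → ℝ}
    (hΛ : 0 ≤ Λ) (hnorm : ∀ i, v i ∅ = 0) (hnonneg : ∀ i S, 0 ≤ v i S)
    (hmarg : ∀ i S g, |v i (insert g S) - v i S| ≤ Λ) (hpos : 0 < p) :
    ∃ q : Fin d → ℕ, (∀ j, q j ≤ p) ∧ ∀ i j : Fin (d + 1),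
      |v i (bundle m p q i) - v j (bundle m p q j)| ≤ 5 * Λ := by
  have hex : ∀ x : Fin d → ℕ, ∃ i : Fin (d + 1), (∀ j, x j ≤ p) →
      cutPoint p x (i + 1) < cutPoint p x i ∧
        ∀ j : Fin (d + 1), v j (bundle m p x j) ≤ v i (bundle m p x i) + Λ := by
    intro x
    by_cases hx : ∀ j, x j ≤ p
    · obtain ⟨i, hi⟩ := exists_almost_best hΛ hnorm hnonneg hmarg hpos hx
      exact ⟨i, fun _ => hi⟩
    · exact ⟨0, fun h => absurd h hx⟩
  choose l hl using hex
  obtain ⟨q, hq, hlab⟩ := exists_fully_labelled_cube hpos l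
    (fun x hx j hj hlj => by
      have := (hl x hx).1
      rw [hlj, Fin.val_succ] at this
      exact this.not_ge (cutPoint_succ_le_of_eq_zero hj))
    (fun x hx j hj => by
      by_contra hlt
      rw [not_le, Fin.lt_def, Fin.val_succ] at hlt
      have h1 := (hl x hx).1
      have h2 := antitone_cutPoint hx (Nat.zero_le (l x))
      have h3 := le_cutPoint_of_eq (k := l x + 1) hj (by omega)
      exact h1.not_ge (h2.trans h3))
  have hone : ∀ i j : Fin (d + 1),
      v j (bundle m p q j) - v i (bundle m p q i) ≤ 5 * Λ := by
    intro i j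
    obtain ⟨x, hx, hqx, rfl⟩ := hlab i
    have h1 := (hl x hx).2 j
    have h2 := abs_le.1 (abs_sub_bundle_le (p := p) hΛ (hmarg j) hqx j)
    have h3 := abs_le.1 (abs_sub_bundle_le (p := p) hΛ (hmarg (l x)) hqx (l x))
    linarith [h2.2, h3.1]
  exact ⟨q, hq, fun i j => abs_sub_le_iff.2 ⟨hone j i, hone i j⟩⟩

/-- **Existence of approximately equitable allocations with nonempty
bundles.** For `n ≤ m` agents with normalized, nonnegative valuations on
subsets of `m` items whose marginal values are at most `Λ ≥ 1`, there is a
partition of the items into nonempty bundles `A 1, …, A n` that is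
equitable within the additive factor `5Λ + 1`. -/
theorem stmt_13 (n m : ℕ) (hn : 1 ≤ n) (hm : 1 ≤ m) (hnm : n ≤ m)
    (Λ : ℝ) (hΛ : 1 ≤ Λ) (v : Fin n → Finset (Fin m) → ℝ)
    (hnorm : ∀ i, v i ∅ = 0)
    (hnonneg : ∀ i S, 0 ≤ v i S)
    (hmarg : ∀ i (S : Finset (Fin m)) (g : Fin m), |v i (insert g S) - v i S| ≤ Λ) :
    ∃ A : Fin n → Finset (Fin m),
      (∀ i j : Fin n, i ≠ j → Disjoint (A i) (A j)) ∧
      (Finset.univ.biUnion A = Finset.univ) ∧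
      (∀ i, (A i).Nonempty) ∧
      (∀ i j : Fin n, |v i (A i) - v j (A j)| ≤ 5 * Λ + 1) := by
  have hΛ0 : 0 ≤ Λ := zero_le_one.trans hΛ
  obtain ⟨d, rfl⟩ := Nat.exists_eq_succ_of_ne_zero (Nat.one_le_iff_ne_zero.1 hn)
  obtain ⟨p, hp⟩ := Nat.exists_eq_add_of_le' hnm
  rcases Nat.eq_zero_or_pos p with rfl | hpos
  · rw [zero_add] at hp
    subst hp
    have hle : ∀ i, v i {i} ≤ Λ := fun i => by
      have := hmarg i ∅ i
      rw [hnorm, sub_zero, insert_empty_eq] at this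
      exact (le_abs_self _).trans this
    refine ⟨fun i => {i}, fun i j hij => by simpa using hij, by ext i; simp,
      fun i => singleton_nonempty i, fun i j => ?_⟩
    rw [abs_sub_le_iff]
    constructor <;> linarith [hle i, hle j, hnonneg i {i}, hnonneg j {j}]
  · obtain ⟨q, hq, hequi⟩ := exists_equitable_bundle hΛ0 hnorm hnonneg hmarg hpos
    refine ⟨fun i => bundle m p q i,
      fun i j hij => disjoint_bundle m hq fun h => hij (Fin.ext h), ?_,
      bundle_nonempty hp hq, fun i j => (hequi i j).trans (by linarith)⟩
    ext g
    simpa using exists_mem_bundle hp q g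
end

section
/- Let n ≥ 1, m ≥ 1, and Λ ≥ 1. For each i ∈ {1, …, n}, let v_i be a real-valued function on subsets of {1, …, m} that is normalized (v_i(∅) = 0), nonnegative (v_i(S) ≥ 0 for all S), and has marginal values at most Λ (|v_i(S ∪ {g}) − v_i(S)| ≤ Λ for all S ⊆ {1, …, m} and g ∈ {1, …, m}). Then there exists a partition of {1, …, m} into subsets A_1, …, A_n (pairwise disjoint with A_1 ∪ … ∪ A_n = {1, …, m}, bundles possibly empty) such that |v_i(A_i) − v_j(A_j)| ≤ 3Λ + 1 for all i, j ∈ {1, …, n}. -/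
open Finset

section PoincareMiranda

variable {ι : Type*} [DecidableEq ι]

/-- The mod 2 cup product `dg₁ ∪ ⋯ ∪ dgₖ` of the coboundaries of the functions in a list,
evaluated on the lattice cube with lowest vertex `x` and directions `S`, as a sum over the
monotone lattice paths in that cube. -/
def cupCoboundary : List ((ι → ℕ) → ZMod 2) → (ι → ℕ) → Finset ι → ZMod 2
  | [], _, _ => 1
  | g :: L, x, S => ∑ j ∈ S, (g (x + Pi.single j 1) + g x) *
      cupCoboundary L (x + Pi.single j 1) (S.erase j)

theorem sum_sum_erase_eq_zero_of_symm (S : Finset ι) (F : ι → ι → ZMod 2)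
    (hF : ∀ i j, F i j = F j i) : ∑ i ∈ S, ∑ j ∈ S.erase i, F i j = 0 := by
  induction S using Finset.induction_on with
  | empty => simp
  | insert a S ha ih =>
    rw [sum_insert ha, erase_insert ha]
    have h : ∀ i ∈ S, ∑ j ∈ (insert a S).erase i, F i j = F a i + ∑ j ∈ S.erase i, F i j := by
      intro i hi
      have hai : a ≠ i := fun h => ha (h ▸ hi)
      rw [erase_insert_of_ne hai, sum_insert (fun h => ha (mem_of_mem_erase h)), hF i a]
    rw [sum_congr rfl h, sum_add_distrib, ih, add_zero, CharTwo.add_self_eq_zero]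

theorem sum_sum_erase_comm (S : Finset ι) (F : ι → ι → ZMod 2) :
    ∑ i ∈ S, ∑ j ∈ S.erase i, F i j = ∑ i ∈ S, ∑ j ∈ S.erase i, F j i := by
  refine sum_comm' ?_
  intro i j
  simp only [mem_erase]
  tauto

/-- Cup products of coboundaries are closed. -/
theorem sum_cupCoboundary_eq_zero (L : List ((ι → ℕ) → ZMod 2)) (x : ι → ℕ) (S : Finset ι) :
    ∑ j ∈ S, (cupCoboundary L (x + Pi.single j 1) (S.erase j) +
      cupCoboundary L x (S.erase j)) = 0 := by
  induction L generalizing x S with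
  | nil => simp [cupCoboundary, CharTwo.add_self_eq_zero]
  | cons g L ih =>
    simp only [cupCoboundary]
    have h₁ : ∑ i ∈ S, ∑ j ∈ S.erase i, g (x + Pi.single i 1 + Pi.single j 1) *
        cupCoboundary L (x + Pi.single i 1 + Pi.single j 1) ((S.erase i).erase j) = 0 := by
      refine sum_sum_erase_eq_zero_of_symm S _ fun i j => ?_
      rw [add_right_comm, erase_right_comm]
    have h₂ : ∑ i ∈ S, ∑ j ∈ S.erase i, g (x + Pi.single i 1) *
        (cupCoboundary L (x + Pi.single i 1 + Pi.single j 1) ((S.erase i).erase j) +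
          cupCoboundary L (x + Pi.single i 1) ((S.erase i).erase j)) = 0 := by
      refine sum_eq_zero fun i _ => ?_
      rw [← mul_sum, ih, mul_zero]
    have h₃ : ∑ i ∈ S, ∑ j ∈ S.erase i, g x *
        (cupCoboundary L (x + Pi.single j 1) ((S.erase i).erase j) +
          cupCoboundary L x ((S.erase i).erase j)) = 0 := by
      refine sum_eq_zero fun i _ => ?_
      rw [← mul_sum, ih, mul_zero]
    have h₄ : ∑ i ∈ S, ∑ j ∈ S.erase i, g x *
        cupCoboundary L x ((S.erase i).erase j) = 0 := by
      refine sum_sum_erase_eq_zero_of_symm S _ fun i j => ?_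
      rw [erase_right_comm]
    have h₅ : ∑ i ∈ S, ∑ j ∈ S.erase i, g (x + Pi.single i 1) *
          cupCoboundary L (x + Pi.single i 1) ((S.erase i).erase j) =
        ∑ i ∈ S, ∑ j ∈ S.erase i, g (x + Pi.single j 1) *
          cupCoboundary L (x + Pi.single j 1) ((S.erase i).erase j) := by
      rw [sum_sum_erase_comm]
      simp only [erase_right_comm]
    simp only [add_mul, mul_add, sum_add_distrib] at h₂ h₃ ⊢
    linear_combination h₁ + h₂ + h₃ - h₄ - h₅

/-- Discrete Stokes formula for `cupCoboundary` at a single cube. -/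
theorem cupCoboundary_cons (g : (ι → ℕ) → ZMod 2) (L : List ((ι → ℕ) → ZMod 2))
    (x : ι → ℕ) (S : Finset ι) :
    cupCoboundary (g :: L) x S = ∑ j ∈ S,
      (g (x + Pi.single j 1) * cupCoboundary L (x + Pi.single j 1) (S.erase j) +
        g x * cupCoboundary L x (S.erase j)) := by
  have h := congrArg (g x * ·) (sum_cupCoboundary_eq_zero L x S)
  simp only [mul_sum, mul_zero] at h
  rw [cupCoboundary, ← add_zero (∑ j ∈ S, _), ← h, ← sum_add_distrib]
  refine sum_congr rfl fun j _ => ?_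
  linear_combination (g x * cupCoboundary L (x + Pi.single j 1) (S.erase j)) *
    (CharTwo.two_eq_zero (R := ZMod 2))

theorem cupCoboundary_eq_zero_of_const {L : List ((ι → ℕ) → ZMod 2)} {g : (ι → ℕ) → ZMod 2}
    (hg : g ∈ L) {x : ι → ℕ} {S : Finset ι} {c : ZMod 2}
    (hc : ∀ z, (∀ j, x j ≤ z j ∧ z j ≤ x j + if j ∈ S then 1 else 0) → g z = c) :
    cupCoboundary L x S = 0 := by
  induction L generalizing x S with
  | nil => simp at hg
  | cons k L ih =>
    rw [cupCoboundary]
    refine sum_eq_zero fun j hj => ?_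
    rcases List.mem_cons.1 hg with rfl | hg
    · rw [hc x (by simp), hc (x + Pi.single j 1), CharTwo.add_self_eq_zero, zero_mul]
      intro l
      rcases eq_or_ne l j with rfl | hl
      · simp [hj]
      · simp [hl]
    · rw [ih hg, mul_zero]
      intro z hz
      refine hc z fun l => ?_
      have := hz l
      rcases eq_or_ne l j with rfl | hl
      · simp_all
        omega
      · simp_all

variable [Fintype ι]

/-- Lowest vertices of the unit cubes with directions `S` in the box of side `M` through `y`. -/
def cubeBases (M : ℕ) (S : Finset ι) (y : ι → ℕ) : Finset (ι → ℕ) :=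
  Fintype.piFinset fun i => if i ∈ S then range M else {y i}

theorem mem_cubeBases {M : ℕ} {S : Finset ι} {y x : ι → ℕ} :
    x ∈ cubeBases M S y ↔ ∀ i, (i ∈ S → x i < M) ∧ (i ∉ S → x i = y i) := by
  rw [cubeBases, Fintype.mem_piFinset]
  refine forall_congr' fun i => ?_
  by_cases h : i ∈ S <;> simp [h]

theorem sum_cubeBases_slice (M : ℕ) {S : Finset ι} (y : ι → ℕ) {j : ι} (hj : j ∈ S)
    (h : (ι → ℕ) → ZMod 2) :
    ∑ x ∈ cubeBases M S y, h x =
      ∑ t ∈ range M, ∑ x ∈ cubeBases M (S.erase j) (Function.update y j t), h x := by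
  rw [← sum_fiberwise_of_maps_to (g := fun x : ι → ℕ => x j) (t := range M)
    (fun x hx => mem_range.2 ((mem_cubeBases.1 hx j).1 hj))]
  refine sum_congr rfl fun t ht => sum_congr ?_ fun _ _ => rfl
  ext x
  rw [mem_filter, mem_cubeBases, mem_cubeBases]
  constructor
  · rintro ⟨hx, rfl⟩ i
    rcases eq_or_ne i j with rfl | hi
    · simp
    · simpa [hi] using hx i
  · intro hx
    have hxj : x j = t := by simpa using hx j
    refine ⟨fun i => ?_, hxj⟩
    rcases eq_or_ne i j with rfl | hi
    · simpa [hj, hxj] using ht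
    · simpa [hi] using hx i

theorem sum_cubeBases_shift (M : ℕ) {S : Finset ι} (y : ι → ℕ) {j : ι} (hj : j ∉ S) (t : ℕ)
    (h : (ι → ℕ) → ZMod 2) :
    ∑ x ∈ cubeBases M S (Function.update y j t), h (x + Pi.single j 1) =
      ∑ x ∈ cubeBases M S (Function.update y j (t + 1)), h x := by
  refine sum_nbij' (fun x => x + Pi.single j 1) (fun x => x - Pi.single j 1) ?_ ?_ ?_ ?_ ?_
  · intro x hx
    rw [mem_cubeBases] at hx ⊢
    intro i
    rcases eq_or_ne i j with rfl | hi
    · simpa [hj] using hx i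
    · simpa [hi] using hx i
  · intro x hx
    rw [mem_cubeBases] at hx ⊢
    intro i
    rcases eq_or_ne i j with rfl | hi
    · have := hx i
      simp_all
    · simpa [hi] using hx i
  · intro x _
    simp
  · intro x hx
    have hxj : x j = t + 1 := by simpa [hj] using mem_cubeBases.1 hx j
    ext i
    rcases eq_or_ne i j with rfl | hi
    · simp [hxj]
    · simp [hi]
  · intro x _
    rfl

theorem sum_cubeBases_telescope (M : ℕ) {S : Finset ι} (y : ι → ℕ) {j : ι} (hj : j ∈ S)
    (h : (ι → ℕ) → ZMod 2) :
    ∑ x ∈ cubeBases M S y, (h (x + Pi.single j 1) + h x) =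
      ∑ x ∈ cubeBases M (S.erase j) (Function.update y j M), h x +
        ∑ x ∈ cubeBases M (S.erase j) (Function.update y j 0), h x := by
  rw [sum_cubeBases_slice M y hj]
  simp only [sum_add_distrib, sum_cubeBases_shift M y (notMem_erase j S)]
  rw [← sum_add_distrib]
  have := sum_range_sub
    (fun t => ∑ x ∈ cubeBases M (S.erase j) (Function.update y j t), h x) M
  simpa only [CharTwo.sub_eq_add] using this

variable {M : ℕ} {f : ι → (ι → ℕ) → ZMod 2}

theorem sum_cupCoboundary_face_eq_zero {l : List ι} {j : ι} (hj : j ∈ l) {S : Finset ι}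
    (hjS : j ∉ S) {c t : ℕ} (hc : ∀ x, x j = t → f j x = c) (y : ι → ℕ)
    (g : (ι → ℕ) → ZMod 2) :
    ∑ x ∈ cubeBases M S (Function.update y j t), g x * cupCoboundary (l.map f) x S = 0 := by
  refine sum_eq_zero fun x hx => ?_
  have hxj : x j = t := by simpa [hjS] using mem_cubeBases.1 hx j
  rw [cupCoboundary_eq_zero_of_const (List.mem_map_of_mem hj) (c := c), mul_zero]
  intro z hz
  have := hz j
  simp only [hjS, if_false] at this
  exact hc z (by omega)

theorem sum_cupCoboundary_eq_one (h₀ : ∀ i x, x i = 0 → f i x = 0)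
    (h₁ : ∀ i x, x i = M → f i x = 1) (l : List ι) (hl : l.Nodup) (y : ι → ℕ) :
    ∑ x ∈ cubeBases M l.toFinset y, cupCoboundary (l.map f) x l.toFinset = 1 := by
  induction l generalizing y with
  | nil =>
    simp [cupCoboundary, cubeBases]
  | cons i l ih =>
    obtain ⟨hi, hl⟩ := List.nodup_cons.1 hl
    have hiS : i ∉ l.toFinset := by simpa using hi
    rw [List.map_cons, List.toFinset_cons]
    simp only [cupCoboundary_cons]
    rw [sum_comm, sum_insert hiS, sum_eq_zero (s := l.toFinset), add_zero]
    · rw [sum_cubeBases_telescope M y (mem_insert_self i _)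
        (fun x => f i x * cupCoboundary (l.map f) x ((insert i l.toFinset).erase i)),
        erase_insert hiS]
      rw [sum_eq_zero (s := cubeBases M l.toFinset (Function.update y i 0)), add_zero,
        ← ih hl (Function.update y i M)]
      · refine sum_congr rfl fun x hx => ?_
        rw [h₁ i x (by simpa [hi] using mem_cubeBases.1 hx i), one_mul]
      · intro x hx
        rw [h₀ i x (by simpa [hi] using mem_cubeBases.1 hx i), zero_mul]
    · intro j hj
      rw [sum_cubeBases_telescope M y (mem_insert_of_mem hj)
        (fun x => f i x * cupCoboundary (l.map f) x ((insert i l.toFinset).erase j))]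
      rw [sum_cupCoboundary_face_eq_zero (c := 1) (List.mem_toFinset.1 hj) (notMem_erase _ _)
          (by simpa using h₁ j),
        sum_cupCoboundary_face_eq_zero (c := 0) (List.mem_toFinset.1 hj) (notMem_erase _ _)
          (by simpa using h₀ j), add_zero]

/-- **Discrete Poincaré–Miranda theorem.** -/
theorem exists_cube_forall_mem_both (P : ι → (ι → ℕ) → Prop)
    (h₀ : ∀ i x, x i = 0 → ¬ P i x) (h₁ : ∀ i x, x i = M → P i x) :
    ∃ x : ι → ℕ, (∀ i, x i < M) ∧ ∀ i,
      (∃ z, (∀ j, x j ≤ z j ∧ z j ≤ x j + 1) ∧ P i z) ∧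
      (∃ z, (∀ j, x j ≤ z j ∧ z j ≤ x j + 1) ∧ ¬ P i z) := by
  classical
  set f : ι → (ι → ℕ) → ZMod 2 := fun i x => if P i x then 1 else 0 with hf
  have hsum := sum_cupCoboundary_eq_one (M := M) (f := f) (fun i x hx => by simp [hf, h₀ i x hx])
    (fun i x hx => by simp [hf, h₁ i x hx]) univ.toList (nodup_toList _) 0
  rw [toList_toFinset] at hsum
  obtain ⟨x, hx, hne⟩ := exists_ne_zero_of_sum_ne_zero (hsum.trans_ne one_ne_zero)
  refine ⟨x, fun i => (mem_cubeBases.1 hx i).1 (mem_univ i), fun i => ?_⟩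
  have hi : f i ∈ univ.toList.map f := List.mem_map_of_mem (by simp)
  constructor <;> by_contra! hcon
  · refine hne (cupCoboundary_eq_zero_of_const hi (c := 0) fun z hz => ?_)
    simp [hf, hcon z (by simpa using hz)]
  · refine hne (cupCoboundary_eq_zero_of_const hi (c := 1) fun z hz => ?_)
    simp [hf, hcon z (by simpa using hz)]

end PoincareMiranda

section Segments

variable {m : ℕ}

/-- The items with (zero-based) index in `[p, q)`. -/
def itemSegment (m p q : ℕ) : Finset (Fin m) :=
  {g | p ≤ g.val ∧ g.val < q}

theorem mem_itemSegment {p q : ℕ} {g : Fin m} :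
    g ∈ itemSegment m p q ↔ p ≤ g.val ∧ g.val < q := by
  simp [itemSegment]

theorem itemSegment_self (p : ℕ) : itemSegment m p p = ∅ := by
  ext g
  simp only [mem_itemSegment, notMem_empty, iff_false]
  omega

theorem itemSegment_eq_or_insert_left (p q : ℕ) :
    itemSegment m p q = itemSegment m (p + 1) q ∨
      ∃ g, itemSegment m p q = insert g (itemSegment m (p + 1) q) := by
  by_cases hp : p < m ∧ p < q
  · refine Or.inr ⟨⟨p, hp.1⟩, ?_⟩
    ext g
    simp only [mem_insert, mem_itemSegment, Fin.ext_iff]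
    omega
  · refine Or.inl ?_
    ext g
    have := g.isLt
    simp only [mem_itemSegment]
    omega

theorem itemSegment_eq_or_insert_right (p q : ℕ) :
    itemSegment m p (q + 1) = itemSegment m p q ∨
      ∃ g, itemSegment m p (q + 1) = insert g (itemSegment m p q) := by
  by_cases hq : q < m ∧ p ≤ q
  · refine Or.inr ⟨⟨q, hq.1⟩, ?_⟩
    ext g
    simp only [mem_insert, mem_itemSegment, Fin.ext_iff]
    omega
  · refine Or.inl ?_
    ext g
    have := g.isLt
    simp only [mem_itemSegment]
    omega

/-- A monotone sequence of cuts from `0` to `m` partitions the items. -/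
theorem itemSegment_partition {n : ℕ} {p : ℕ → ℕ} (hp : Monotone p) (h0 : p 0 = 0)
    (hn : p n = m) :
    (∀ i j : Fin n, i ≠ j →
      Disjoint (itemSegment m (p i) (p (i + 1))) (itemSegment m (p j) (p (j + 1)))) ∧
    univ.biUnion (fun i : Fin n => itemSegment m (p i) (p (i + 1))) = univ := by
  constructor
  · intro i j hij
    rw [disjoint_left]
    intro g hi hj
    rw [mem_itemSegment] at hi hj
    rcases lt_or_gt_of_ne hij with h | h
    · have := hp (Nat.succ_le_of_lt (Fin.lt_def.1 h))
      simp only [Nat.succ_eq_add_one] at this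
      omega
    · have := hp (Nat.succ_le_of_lt (Fin.lt_def.1 h))
      simp only [Nat.succ_eq_add_one] at this
      omega
  · ext g
    simp only [mem_biUnion, mem_univ, true_and, iff_true, mem_itemSegment]
    have hex : ∃ k, g.val < p k := ⟨n, hn ▸ g.isLt⟩
    classical
    have hlt := Nat.find_spec hex
    have hle : Nat.find hex ≤ n := Nat.find_min' hex (hn ▸ g.isLt)
    obtain ⟨k, hk⟩ : ∃ k, Nat.find hex = k + 1 := by
      refine Nat.exists_eq_succ_of_ne_zero fun h => ?_
      rw [h, h0] at hlt
      exact Nat.not_lt_zero _ hlt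
    have hmin := Nat.find_min hex (m := k) (by omega)
    exact ⟨⟨k, by omega⟩, not_lt.1 hmin, hk ▸ hlt⟩

/-- A function on `ℕ` with unit steps at most `Λ` is `Λ`-Lipschitz. -/
theorem abs_sub_le_of_step {u : ℕ → ℝ} {Λ : ℝ} (hu : ∀ k, |u (k + 1) - u k| ≤ Λ) (a b : ℕ) :
    |u a - u b| ≤ Λ * |(a : ℝ) - b| := by
  have key : ∀ a k : ℕ, |u (a + k) - u a| ≤ Λ * k := by
    intro a k
    induction k with
    | zero => simp
    | succ k ih =>
      have h := abs_sub_le (u (a + (k + 1))) (u (a + k)) (u a)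
      have h' := hu (a + k)
      push_cast
      rw [← add_assoc] at h ⊢
      linarith
  rcases le_total a b with h | h
  · obtain ⟨k, rfl⟩ := Nat.exists_eq_add_of_le h
    rw [abs_sub_comm, abs_sub_comm (a : ℝ)]
    simpa using key a k
  · obtain ⟨k, rfl⟩ := Nat.exists_eq_add_of_le h
    simpa using key b k

variable {Λ : ℝ} {v : Finset (Fin m) → ℝ}

theorem abs_itemSegment_sub_le (hΛ : 0 ≤ Λ) (hv : ∀ S g, |v (insert g S) - v S| ≤ Λ)
    (p q p' q' : ℕ) :
    |v (itemSegment m p q) - v (itemSegment m p' q')| ≤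
      Λ * (|(p : ℝ) - p'| + |(q : ℝ) - q'|) := by
  have hl := abs_sub_le_of_step (u := fun k => v (itemSegment m k q)) (Λ := Λ) (fun k => by
    rcases itemSegment_eq_or_insert_left (m := m) k q with h | ⟨g, h⟩
    · simpa [h] using hΛ
    · rw [abs_sub_comm, h]
      exact hv _ _) p p'
  have hr := abs_sub_le_of_step (u := fun k => v (itemSegment m p' k)) (Λ := Λ) (fun k => by
    rcases itemSegment_eq_or_insert_right (m := m) p' k with h | ⟨g, h⟩
    · simpa [h] using hΛ
    · rw [h]
      exact hv _ _) q q'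
  have := abs_sub_le (v (itemSegment m p q)) (v (itemSegment m p' q)) (v (itemSegment m p' q'))
  linarith

theorem sum_range_add_div {N : ℕ} (hN : 0 < N) (l : ℕ) : ∑ θ ∈ range N, (l + θ) / N = l := by
  induction l with
  | zero =>
    refine sum_eq_zero fun θ hθ => ?_
    rw [zero_add, Nat.div_eq_of_lt (mem_range.1 hθ)]
  | succ l ih =>
    have h := (sum_range_succ (fun θ => (l + θ) / N) N).symm.trans
      (sum_range_succ' (fun θ => (l + θ) / N) N)
    rw [ih, add_zero, Nat.add_div_right _ hN] at h
    have : ∑ θ ∈ range N, (l + 1 + θ) / N = ∑ θ ∈ range N, (l + (θ + 1)) / N :=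
      sum_congr rfl fun θ _ => by rw [add_assoc, add_comm 1]
    omega

theorem sum_abs_div_sub_div {N : ℕ} (hN : 0 < N) (l l' : ℕ) :
    ∑ θ ∈ range N, |(((l + θ) / N : ℕ) : ℝ) - ((l' + θ) / N : ℕ)| = |(l : ℝ) - l'| := by
  wlog h : l' ≤ l generalizing l l'
  · rw [abs_sub_comm, ← this l' l (le_of_not_ge h)]
    exact sum_congr rfl fun θ _ => abs_sub_comm _ _
  have h' : ∀ θ ∈ range N, |(((l + θ) / N : ℕ) : ℝ) - ((l' + θ) / N : ℕ)| =
      (((l + θ) / N : ℕ) : ℝ) - ((l' + θ) / N : ℕ) := fun θ _ =>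
    abs_of_nonneg (sub_nonneg.2 (Nat.cast_le.2 (Nat.div_le_div_right (by omega))))
  rw [sum_congr rfl h', sum_sub_distrib, ← Nat.cast_sum, ← Nat.cast_sum,
    sum_range_add_div hN, sum_range_add_div hN, abs_of_nonneg (sub_nonneg.2 (Nat.cast_le.2 h))]

/-- `N` times the value of the fractional segment `[l / N, r / N)`, both of whose ends are
rounded with a common offset `θ / N`, averaged over `θ`. -/
noncomputable def smoothedValue (v : Finset (Fin m) → ℝ) (N l r : ℕ) : ℝ :=
  ∑ θ ∈ range N, v (itemSegment m ((l + θ) / N) ((r + θ) / N))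

theorem smoothedValue_nonneg (hv : ∀ S, 0 ≤ v S) (N l r : ℕ) : 0 ≤ smoothedValue v N l r :=
  sum_nonneg fun _ _ => hv _

theorem smoothedValue_self (hv : v ∅ = 0) (N l : ℕ) : smoothedValue v N l l = 0 := by
  simp [smoothedValue, itemSegment_self, hv]

theorem smoothedValue_mul (v : Finset (Fin m) → ℝ) (N p q : ℕ) :
    smoothedValue v N (N * p) (N * q) = N * v (itemSegment m p q) := by
  rw [smoothedValue, sum_congr rfl (g := fun _ => v (itemSegment m p q)), sum_const, card_range,
    nsmul_eq_mul]
  intro θ hθ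
  have hθ := mem_range.1 hθ
  rw [Nat.mul_add_div (by omega), Nat.mul_add_div (by omega), Nat.div_eq_of_lt hθ, add_zero,
    add_zero]

theorem abs_smoothedValue_sub_le (hΛ : 0 ≤ Λ) (hv : ∀ S g, |v (insert g S) - v S| ≤ Λ)
    {N : ℕ} (hN : 0 < N) (l r l' r' : ℕ) :
    |smoothedValue v N l r - smoothedValue v N l' r'| ≤
      Λ * (|(l : ℝ) - l'| + |(r : ℝ) - r'|) := by
  rw [smoothedValue, smoothedValue, ← sum_sub_distrib, ← sum_abs_div_sub_div hN l l',
    ← sum_abs_div_sub_div hN r r', ← sum_add_distrib, mul_sum]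
  exact (abs_sum_le_sum_abs _ _).trans
    (sum_le_sum fun θ _ => abs_itemSegment_sub_le hΛ hv _ _ _ _)

end Segments

section Cuts

variable {d : ℕ}

/-- The `k`-th cut point of `[0, M]` obtained from `x` by taking running maxima. -/
def runningCut (M : ℕ) (x : Fin d → ℕ) (k : ℕ) : ℕ :=
  if k ≤ d then ({j : Fin d | j.val < k} : Finset (Fin d)).sup x else M

theorem runningCut_zero (M : ℕ) (x : Fin d → ℕ) : runningCut M x 0 = 0 := by
  simp [runningCut]

theorem runningCut_last (M : ℕ) (x : Fin d → ℕ) : runningCut M x (d + 1) = M := by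
  simp [runningCut]

theorem runningCut_le {M : ℕ} {x : Fin d → ℕ} (hx : ∀ j, x j ≤ M) (k : ℕ) :
    runningCut M x k ≤ M := by
  unfold runningCut
  split_ifs
  · exact Finset.sup_le fun j _ => hx j
  · exact le_rfl

theorem runningCut_mono {M : ℕ} {x : Fin d → ℕ} (hx : ∀ j, x j ≤ M) :
    Monotone (runningCut M x) := by
  intro a b hab
  by_cases hb : b ≤ d
  · rw [runningCut, runningCut, if_pos hb, if_pos (hab.trans hb)]
    refine Finset.sup_mono fun j hj => ?_
    simp only [mem_filter, mem_univ, true_and] at hj ⊢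
    omega
  · refine (runningCut_le hx a).trans_eq ?_
    rw [runningCut, if_neg hb]

theorem runningCut_succ_of_eq_zero (M : ℕ) {x : Fin d → ℕ} {j : Fin d} (hj : x j = 0) :
    runningCut M x (j + 1) = runningCut M x j := by
  have hjd := j.isLt
  have h : ({i : Fin d | i.val < j + 1} : Finset (Fin d)) =
      insert j ({i : Fin d | i.val < j} : Finset (Fin d)) := by
    ext i
    simp only [mem_insert, mem_filter, mem_univ, true_and, Fin.ext_iff]
    omega
  rw [runningCut, runningCut, if_pos (by omega), if_pos (by omega), h, Finset.sup_insert, hj]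
  simp

theorem runningCut_succ_of_eq_top {M : ℕ} {x : Fin d → ℕ} (hx : ∀ j, x j ≤ M) {j : Fin d}
    (hj : x j = M) : runningCut M x (j + 1) = M := by
  refine (runningCut_le hx _).antisymm ?_
  have hjd := j.isLt
  rw [runningCut, if_pos (by omega)]
  exact hj.symm.le.trans (Finset.le_sup (f := x) (by simp))

theorem runningCut_le_add_one (M : ℕ) {x z : Fin d → ℕ} (h : ∀ j, z j ≤ x j + 1) (k : ℕ) :
    runningCut M z k ≤ runningCut M x k + 1 := by
  unfold runningCut
  split_ifs
  · refine Finset.sup_le fun j hj => (h j).trans ?_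
    exact Nat.add_le_add_right (Finset.le_sup (f := x) hj) 1
  · exact Nat.le_succ M

theorem abs_runningCut_sub_le (M : ℕ) {x z : Fin d → ℕ} (h : ∀ j, x j ≤ z j ∧ z j ≤ x j + 1)
    (k : ℕ) : |(runningCut M x k : ℝ) - runningCut M z k| ≤ 1 := by
  have h₁ := runningCut_le_add_one M (fun j => (h j).2) k
  have h₂ := runningCut_le_add_one M (x := z) (z := x) (fun j => (h j).1.trans (Nat.le_succ _)) k
  have h₁' : (runningCut M z k : ℝ) ≤ runningCut M x k + 1 := by exact_mod_cast h₁
  have h₂' : (runningCut M x k : ℝ) ≤ runningCut M z k + 1 := by exact_mod_cast h₂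
  rw [abs_le]
  constructor <;> linarith

end Cuts

/-- Some fractional allocation into consecutive segments nearly equalizes the smoothed values
of consecutive agents. -/
theorem exists_cuts_smoothedValue_close {d m M N : ℕ} (hM : 0 < M) (hN : 0 < N) {Λ : ℝ}
    {v : Fin (d + 1) → Finset (Fin m) → ℝ} (hΛ : 0 ≤ Λ) (hnorm : ∀ i, v i ∅ = 0)
    (hnonneg : ∀ i S, 0 ≤ v i S) (hmarg : ∀ i S g, |v i (insert g S) - v i S| ≤ Λ) :
    ∃ c : ℕ → ℕ, Monotone c ∧ c 0 = 0 ∧ c (d + 1) = M ∧ ∀ j : Fin d,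
      |smoothedValue (v j.castSucc) N (c j) (c (j + 1)) -
        smoothedValue (v j.succ) N (c (j + 1)) (c (j + 2))| ≤ 4 * Λ := by
  set H : Fin (d + 1) → (Fin d → ℕ) → ℝ := fun i x =>
    smoothedValue (v i) N (runningCut M x i) (runningCut M x (i + 1)) with hH
  have hH0 : ∀ i x, 0 ≤ H i x := fun i x => smoothedValue_nonneg (hnonneg i) _ _ _
  obtain ⟨x, hxM, hx⟩ := exists_cube_forall_mem_both (M := M)
    (fun (j : Fin d) x => x j ≠ 0 ∧ (x j = M ∨ H j.succ x ≤ H j.castSucc x))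
    (fun j x hj h => h.1 hj) (fun j x hj => ⟨by omega, Or.inl hj⟩)
  refine ⟨runningCut M x, runningCut_mono fun j => (hxM j).le, runningCut_zero M x,
    runningCut_last M x, fun j => ?_⟩
  have hlip : ∀ i z, (∀ j, x j ≤ z j ∧ z j ≤ x j + 1) → |H i x - H i z| ≤ 2 * Λ := by
    intro i z hz
    refine (abs_smoothedValue_sub_le hΛ (hmarg i) hN _ _ _ _).trans ?_
    have h₁ := abs_runningCut_sub_le M hz i
    have h₂ := abs_runningCut_sub_le M hz (i + 1)
    nlinarith
  have hle : ∀ z : Fin d → ℕ, (∀ j, x j ≤ z j ∧ z j ≤ x j + 1) → ∀ j, z j ≤ M := by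
    intro z hz j
    have := hxM j
    have := hz j
    omega
  obtain ⟨⟨z, hz, -, hPz⟩, ⟨w, hw, hPw⟩⟩ := hx j
  have hz' : H j.succ z ≤ H j.castSucc z := by
    rcases hPz with h | h
    · have h₁ := runningCut_succ_of_eq_top (hle z hz) h
      have h₂ : runningCut M z (j + 1 + 1) = M :=
        (runningCut_le (hle z hz) _).antisymm
          (h₁.symm.le.trans (runningCut_mono (hle z hz) (Nat.le_succ _)))
      refine Eq.trans_le ?_ (hH0 _ _)
      simp only [hH, Fin.val_succ, h₁, h₂]
      exact smoothedValue_self (hnorm _) _ _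
    · exact h
  have hw' : H j.castSucc w ≤ H j.succ w := by
    by_cases h : w j = 0
    · refine Eq.trans_le ?_ (hH0 _ _)
      simp only [hH, Fin.val_castSucc, runningCut_succ_of_eq_zero M h]
      exact smoothedValue_self (hnorm _) _ _
    · by_contra! hlt
      exact hPw ⟨h, Or.inr hlt.le⟩
  have e₁ := abs_le.1 (hlip j.castSucc z hz)
  have e₂ := abs_le.1 (hlip j.succ z hz)
  have e₃ := abs_le.1 (hlip j.castSucc w hw)
  have e₄ := abs_le.1 (hlip j.succ w hw)
  change |H j.castSucc x - H j.succ x| ≤ 4 * Λ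
  rw [abs_le]
  constructor <;> linarith

theorem abs_mul_round_sub_le {h : ℕ} (hh : 0 < h) (a : ℕ) :
    |((2 * h * ((a + h) / (2 * h)) : ℕ) : ℝ) - a| ≤ h := by
  have h₁ := Nat.div_add_mod (a + h) (2 * h)
  have h₂ := Nat.mod_lt (a + h) (y := 2 * h) (by omega)
  generalize 2 * h * ((a + h) / (2 * h)) = b at *
  have h₃ : a ≤ b + h := by omega
  have h₄ : b ≤ a + h := by omega
  rw [abs_le]
  have h₃' : (a : ℝ) ≤ b + h := by exact_mod_cast h₃
  have h₄' : (b : ℝ) ≤ a + h := by exact_mod_cast h₄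
  constructor <;> linarith

/-- **Existence of approximately equitable allocations (bundles possibly
empty).** For `n` agents with normalized, nonnegative valuations on subsets
of `m` items whose marginal values are at most `Λ ≥ 1`, there is a partition
of the items into bundles `A 1, …, A n` (possibly empty) that is equitable
within the additive factor `3Λ + 1`. -/
theorem stmt_14 (n m : ℕ) (hn : 1 ≤ n) (hm : 1 ≤ m)
    (Λ : ℝ) (hΛ : 1 ≤ Λ) (v : Fin n → Finset (Fin m) → ℝ)
    (hnorm : ∀ i, v i ∅ = 0)
    (hnonneg : ∀ i S, 0 ≤ v i S)
    (hmarg : ∀ i (S : Finset (Fin m)) (g : Fin m), |v i (insert g S) - v i S| ≤ Λ) :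
    ∃ A : Fin n → Finset (Fin m),
      (∀ i j : Fin n, i ≠ j → Disjoint (A i) (A j)) ∧
      (Finset.univ.biUnion A = Finset.univ) ∧
      (∀ i j : Fin n, |v i (A i) - v j (A j)| ≤ 3 * Λ + 1) := by
  obtain ⟨d, rfl⟩ : ∃ d, n = d + 1 := ⟨n - 1, by omega⟩
  obtain ⟨h, hh⟩ : ∃ h, h = 4 * (d + 1) := ⟨_, rfl⟩
  have hΛ0 : 0 ≤ Λ := zero_le_one.trans hΛ
  have hhpos : 0 < h := by omega
  have hNpos : 0 < 2 * h := by omega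
  obtain ⟨c, hcmono, hc0, hclast, hc⟩ := exists_cuts_smoothedValue_close (N := 2 * h)
    (Nat.mul_pos hNpos hm) hNpos hΛ0 hnorm hnonneg hmarg
  obtain ⟨hdisj, hcover⟩ := itemSegment_partition (m := m) (n := d + 1)
    (p := fun k => (c k + h) / (2 * h))
    (fun a b hab => Nat.div_le_div_right (Nat.add_le_add_right (hcmono hab) h))
    (by simpa [hc0] using Or.inr (by omega))
    (by rw [hclast, Nat.mul_add_div hNpos, Nat.div_eq_of_lt (by omega), add_zero])
  refine ⟨_, hdisj, hcover, fun i j => ?_⟩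
  have hhR : (h : ℝ) = 4 * (d + 1) := by exact_mod_cast hh
  set H : Fin (d + 1) → ℝ := fun i => smoothedValue (v i) (2 * h) (c i) (c (i + 1)) with hH
  have hround : ∀ i : Fin (d + 1), |2 * h * v i (itemSegment m ((c i + h) / (2 * h))
      ((c (i + 1) + h) / (2 * h))) - H i| ≤ 2 * h * Λ := by
    intro i
    have hlip := abs_smoothedValue_sub_le hΛ0 (hmarg i) hNpos (2 * h * ((c i + h) / (2 * h)))
      (2 * h * ((c (i + 1) + h) / (2 * h))) (c i) (c (i + 1))
    rw [smoothedValue_mul] at hlip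
    have h₁ := abs_mul_round_sub_le hhpos (c i)
    have h₂ := abs_mul_round_sub_le hhpos (c (i + 1))
    push_cast at hlip h₁ h₂ ⊢
    refine hlip.trans ?_
    nlinarith
  have hchain : ∀ i : Fin (d + 1), |H i - H 0| ≤ h * Λ := by
    have key : ∀ i : Fin (d + 1), |H i - H 0| ≤ 4 * Λ * (i : ℕ) := by
      intro i
      induction i using Fin.induction with
      | zero => simp
      | succ j ih =>
        have h₁ : |H j.castSucc - H j.succ| ≤ 4 * Λ := hc j
        have h₂ := abs_sub_le (H j.succ) (H j.castSucc) (H 0)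
        rw [abs_sub_comm] at h₁
        simp only [Fin.val_castSucc] at ih
        simp only [Fin.val_succ, Nat.cast_add, Nat.cast_one]
        linarith
    intro i
    refine (key i).trans ?_
    have : ((i : ℕ) : ℝ) ≤ d + 1 := by exact_mod_cast i.isLt.le
    rw [hhR]
    nlinarith
  have hpos : (0 : ℝ) < 2 * h := by exact_mod_cast hNpos
  have a₁ := abs_le.1 (hround i)
  have a₂ := abs_le.1 (hround j)
  have a₃ := abs_le.1 (hchain i)
  have a₄ := abs_le.1 (hchain j)
  refine le_trans ?_ (le_add_of_nonneg_right zero_le_one)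
  refine le_of_mul_le_mul_left ?_ hpos
  rw [← abs_of_pos hpos, ← abs_mul, abs_of_pos hpos, abs_le]
  constructor <;> linarith
end
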